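/- arXiv:1711.03137 — 3 statements merged into one kernel-verified Lean document; each statement's English description precedes it below -/
import Mathlib

section
/- Let q : ℝ → ℍ be a differentiable curve of unit quaternions (|q(t)| = 1 for all t), and define R_i(t) := q(t)·e_i·q̄(t) for i = 1,2,3, which are purely imaginary quaternions identified with vectors in ℝ³. Then for every t, 2 q̄(t)·q'(t) = ⟨q̄(t)·R₂'(t)·q(t), e₃⟩ e₁ + ⟨q̄(t)·R₃'(t)·q(t), e₁⟩ e₂ + ⟨q̄(t)·R₁'(t)·q(t), e₂⟩ e₃, where the right-hand side is a purely imaginary quaternion. -/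
open Quaternion

/-- The imaginary units of `ℍ[ℝ]`, identified with the canonical basis of `ℝ³`. -/
noncomputable def e1 : ℍ[ℝ] := ⟨0, 1, 0, 0⟩
noncomputable def e2 : ℍ[ℝ] := ⟨0, 0, 1, 0⟩
noncomputable def e3 : ℍ[ℝ] := ⟨0, 0, 0, 1⟩

/-- The Euclidean inner product of `ℝ³` transported to the purely imaginary
quaternions `Im ℍ`. -/
noncomputable def qInner (u v : ℍ[ℝ]) : ℝ :=
  u.imI * v.imI + u.imJ * v.imJ + u.imK * v.imK

instance Quaternion.instStarModuleReal : StarModule ℝ ℍ[ℝ] where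
  star_smul r a := by ext <;> simp

@[simp] theorem e1_re : e1.re = 0 := rfl
@[simp] theorem e1_imI : e1.imI = 1 := rfl
@[simp] theorem e1_imJ : e1.imJ = 0 := rfl
@[simp] theorem e1_imK : e1.imK = 0 := rfl
@[simp] theorem e2_re : e2.re = 0 := rfl
@[simp] theorem e2_imI : e2.imI = 0 := rfl
@[simp] theorem e2_imJ : e2.imJ = 1 := rfl
@[simp] theorem e2_imK : e2.imK = 0 := rfl
@[simp] theorem e3_re : e3.re = 0 := rfl
@[simp] theorem e3_imI : e3.imI = 0 := rfl
@[simp] theorem e3_imJ : e3.imJ = 0 := rfl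
@[simp] theorem e3_imK : e3.imK = 1 := rfl

/-- A differentiable curve of unit quaternions satisfies `q̄·q' + star (q̄·q') = 0`. -/
theorem star_mul_deriv_add_star_eq_zero {q : ℝ → ℍ[ℝ]} {q' : ℍ[ℝ]} {t : ℝ}
    (hq : HasDerivAt q q' t) (hunit : ∀ s, star (q s) * q s = 1) :
    star (q t) * q' + star (star (q t) * q') = 0 := by
  have h := hq.star.mul hq
  have hconst : (star q * q : ℝ → ℍ[ℝ]) = fun _ => 1 := funext hunit
  have h0 : star q' * q t + star (q t) * q' = 0 :=
    h.unique (hconst ▸ hasDerivAt_const t (1 : ℍ[ℝ]))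
  rw [star_mul, star_star, add_comm]
  exact h0

/-- The derivative of `q·e·q̄`, read in the moving frame, is the commutator of `q̄·q'` and `e`. -/
theorem star_mul_deriv_conj_mul {q : ℝ → ℍ[ℝ]} {q' : ℍ[ℝ]} {t : ℝ}
    (hq : HasDerivAt q q' t) (hunit : ∀ s, star (q s) * q s = 1)
    {e : ℍ[ℝ]} {R : ℝ → ℍ[ℝ]} (hR : ∀ s, R s = q s * e * star (q s)) :
    star (q t) * deriv R t * q t = star (q t) * q' * e - e * (star (q t) * q') := by
  have hderiv : HasDerivAt R (q' * e * star (q t) + q t * e * star q') t := by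
    rw [funext hR]
    exact (hq.mul_const e).mul hq.star
  have hskew := eq_neg_of_add_eq_zero_right (star_mul_deriv_add_star_eq_zero hq hunit)
  rw [star_mul, star_star] at hskew
  calc star (q t) * deriv R t * q t
      = star (q t) * q' * e * (star (q t) * q t)
          + (star (q t) * q t) * e * (star q' * q t) := by
        rw [hderiv.deriv]; noncomm_ring
    _ = _ := by rw [hunit, hskew]; noncomm_ring

/-- if `q : ℝ → ℍ` is a differentiable curve of unit quaternions and
`R_i(t) := q(t)·e_i·q̄(t)`, then
`2 q̄·q' = ⟨q̄·R₂'·q, e₃⟩ e₁ + ⟨q̄·R₃'·q, e₁⟩ e₂ + ⟨q̄·R₁'·q, e₂⟩ e₃`,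
the right-hand side being a purely imaginary quaternion. -/
theorem stmt0 (q : ℝ → ℍ[ℝ]) (hq : Differentiable ℝ q)
    (hunit : ∀ t, ‖q t‖ = 1)
    (R1 R2 R3 : ℝ → ℍ[ℝ])
    (hR1 : ∀ t, R1 t = q t * e1 * star (q t))
    (hR2 : ∀ t, R2 t = q t * e2 * star (q t))
    (hR3 : ∀ t, R3 t = q t * e3 * star (q t)) :
    ∀ t,
      (2 : ℝ) • (star (q t) * deriv q t) =
          qInner (star (q t) * deriv R2 t * q t) e3 • e1
        + qInner (star (q t) * deriv R3 t * q t) e1 • e2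
        + qInner (star (q t) * deriv R1 t * q t) e2 • e3
      ∧ (qInner (star (q t) * deriv R2 t * q t) e3 • e1
        + qInner (star (q t) * deriv R3 t * q t) e1 • e2
        + qInner (star (q t) * deriv R1 t * q t) e2 • e3).re = 0 := by
  intro t
  have hq' := (hq t).hasDerivAt
  have hunit' : ∀ s, star (q s) * q s = 1 := fun s => by
    rw [Quaternion.star_mul_self, Quaternion.normSq_eq_norm_mul_self, hunit]
    simp
  have hskew := star_mul_deriv_add_star_eq_zero hq' hunit'
  rw [star_mul_deriv_conj_mul hq' hunit' hR1, star_mul_deriv_conj_mul hq' hunit' hR2,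
    star_mul_deriv_conj_mul hq' hunit' hR3]
  generalize star (q t) * deriv q t = w at hskew ⊢
  have hre : w.re = 0 := by
    have := congrArg QuaternionAlgebra.re hskew
    simp at this
    linarith
  refine ⟨?_, by simp⟩
  ext <;> simp [qInner, hre] <;> ring
end

section
/- Let X ⊆ ℝ³ be open, let V_{ik} : X → ℝ³ (1 ≤ i,k ≤ 3) be vector fields with symmetric parts V_{ik}^s := (1/2)(V_{ik} + V_{ki}) and antisymmetric parts V_{ik}^a := (1/2)(V_{ik} − V_{ki}), and let G : X → ℝ³ be a vector field. Let q : X → ℍ be differentiable with |q(x)| = 1 for all x ∈ X, set R_i := q·e_i·q̄ ∈ Im ℍ ≅ ℝ³ for i = 1,2,3, and define F := G + (2/3) Σ_{i,j=1}^3 ⟨V_{ij}^s, R_i⟩ R_j. Assume that for every m, i ∈ {1,2,3}, ∂_m R_i = ⟨e_m, V_{ik}^a⟩ R_k − ⟨R_k, e_m⟩ V_{ik}^s + ⟨V_{jk}^s, R_i⟩⟨R_k, e_m⟩ R_j + ⟨F, R_i⟩ e_m − ⟨R_i, e_m⟩ F (with summation over repeated indices j, k from 1 to 3). Then for every m ∈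 {1,2,3}, ∂_m q = (1/2)(q·𝐚^m + 𝐛^m·q), where 𝐛^m := G × e_m, and where, writing T_{q̄}w := q̄·w·q, t := T_{q̄} e_m with components (t₁,t₂,t₃), the purely imaginary quaternion 𝐚^m = a₁^m e₁ + a₂^m e₂ + a₃^m e₃ has components a₁^m = ⟨e_m, V₂₃^a⟩ + Σ_k t_k ((T_{q̄}V_{3k}^s)₂ − (T_{q̄}V_{2k}^s)₃) + (2/3) Σ_k ((T_{q̄}V_{2k}^s)_k t₃ − (T_{q̄}V_{3k}^s)_k t₂), a₂^m = ⟨e_m, V₃₁^a⟩ + Σ_k t_k ((T_{q̄}V_{1k}^s)₃ − (T_{q̄}V_{3k}^s)₁) + (2/3) Σ_k ((T_{q̄}V_{3k}^s)_k t₁ − (T_{q̄}V_{1k}^s)_k t₃), a₃^m = ⟨e_m, V₁₂^a⟩ + Σ_k t_k ((T_{q̄}V_{2k}^s)₁ − (T_{q̄}V_{1k}^s)₂) + (2/3) Σ_k ((T_{q̄}V_{1k}^s)_k t₂ − (T_{q̄}V_{2k}^s)_k t₁), with all sums over k from 1 to 3. -/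
open Quaternion

/-- The imaginary units `e₁, e₂, e₃` of `ℍ[ℝ]`, spanning `Im ℍ ≅ ℝ³`. -/
noncomputable def eb : Fin 3 → ℍ[ℝ] := ![⟨0, 1, 0, 0⟩, ⟨0, 0, 1, 0⟩, ⟨0, 0, 0, 1⟩]

/-- The cross product of `ℝ³` transported to `Im ℍ`. -/
noncomputable def qCross (u v : ℍ[ℝ]) : ℍ[ℝ] :=
  ⟨0, u.imJ * v.imK - u.imK * v.imJ,
      u.imK * v.imI - u.imI * v.imK,
      u.imI * v.imJ - u.imJ * v.imI⟩

/-- The purely imaginary quaternion `𝐚^m = a₁^m e₁ + a₂^m e₂ + a₃^m e₃` of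
Theorem 3.2 ("Dynamical system for q"), built from the pointwise values of the
unit quaternion `q` and of the symmetric/antisymmetric parts `Vs`, `Va` of the
vector fields `V_{ik}`.  Here `T_{q̄} w := q̄·w·q`, `(u)_i := ⟨u, e_i⟩` and
`t := T_{q̄} e_m`. -/
noncomputable def amQ (qx : ℍ[ℝ]) (Vs Va : Fin 3 → Fin 3 → ℍ[ℝ]) (m : Fin 3) :
    ℍ[ℝ] :=
  let T : ℍ[ℝ] → ℍ[ℝ] := fun w => star qx * w * qx
  let c : ℍ[ℝ] → Fin 3 → ℝ := fun u i => qInner u (eb i)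
  let t : Fin 3 → ℝ := fun i => c (T (eb m)) i
  let a1 : ℝ := qInner (eb m) (Va 1 2)
    + (∑ k, t k * (c (T (Vs 2 k)) 1 - c (T (Vs 1 k)) 2))
    + (2 / 3) * ∑ k, (c (T (Vs 1 k)) k * t 2 - c (T (Vs 2 k)) k * t 1)
  let a2 : ℝ := qInner (eb m) (Va 2 0)
    + (∑ k, t k * (c (T (Vs 0 k)) 2 - c (T (Vs 2 k)) 0))
    + (2 / 3) * ∑ k, (c (T (Vs 2 k)) k * t 0 - c (T (Vs 0 k)) k * t 2)
  let a3 : ℝ := qInner (eb m) (Va 0 1)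
    + (∑ k, t k * (c (T (Vs 1 k)) 0 - c (T (Vs 0 k)) 1))
    + (2 / 3) * ∑ k, (c (T (Vs 0 k)) k * t 1 - c (T (Vs 1 k)) k * t 0)
  a1 • eb 0 + a2 • eb 1 + a3 • eb 2

/-- The real-linear map `w ↦ p̄·w·p`. -/
noncomputable def starConj (p : ℍ[ℝ]) : ℍ[ℝ] →ₗ[ℝ] ℍ[ℝ] :=
  LinearMap.mulRight ℝ p ∘ₗ LinearMap.mulLeft ℝ (star p)

theorem starConj_apply (p w : ℍ[ℝ]) : starConj p w = star p * w * p := rfl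

theorem starConj_mul {p : ℍ[ℝ]} (hp : p * star p = 1) (u v : ℍ[ℝ]) :
    starConj p (u * v) = starConj p u * starConj p v := by
  simp only [starConj_apply]
  calc star p * (u * v) * p = star p * u * 1 * v * p := by noncomm_ring
    _ = star p * u * (p * star p) * v * p := by rw [hp]
    _ = _ := by noncomm_ring

theorem starConj_mul_mul_star {p : ℍ[ℝ]} (hp : star p * p = 1) (w : ℍ[ℝ]) :
    starConj p (p * w * star p) = w := by
  simp only [starConj_apply]
  calc star p * (p * w * star p) * p = (star p * p) * w * (star p * p) := by noncomm_ring
    _ = w := by rw [hp]; simp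

theorem mul_starConj {p : ℍ[ℝ]} (hp : p * star p = 1) (w : ℍ[ℝ]) :
    p * starConj p w = w * p := by
  rw [starConj_apply, ← mul_assoc, ← mul_assoc, hp, one_mul]

theorem starConj_re {p w : ℍ[ℝ]} (hw : w.re = 0) : (starConj p w).re = 0 := by
  simp [starConj_apply, hw]
  ring

theorem qInner_comm (u v : ℍ[ℝ]) : qInner u v = qInner v u := by
  simp only [qInner]; ring

@[simp] theorem eb_re (i : Fin 3) : (eb i).re = 0 := by
  fin_cases i <;> rfl

@[simp] theorem eb_zero_imI : (eb 0).imI = 1 := rfl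

@[simp] theorem eb_zero_imJ : (eb 0).imJ = 0 := rfl

@[simp] theorem eb_zero_imK : (eb 0).imK = 0 := rfl

@[simp] theorem eb_one_imI : (eb 1).imI = 0 := rfl

@[simp] theorem eb_one_imJ : (eb 1).imJ = 1 := rfl

@[simp] theorem eb_one_imK : (eb 1).imK = 0 := rfl

@[simp] theorem eb_two_imI : (eb 2).imI = 0 := rfl

@[simp] theorem eb_two_imJ : (eb 2).imJ = 0 := rfl

@[simp] theorem eb_two_imK : (eb 2).imK = 1 := rfl

@[simp] theorem qInner_eb_zero (u : ℍ[ℝ]) : qInner u (eb 0) = u.imI := by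
  simp [qInner]

@[simp] theorem qInner_eb_one (u : ℍ[ℝ]) : qInner u (eb 1) = u.imJ := by
  simp [qInner]

@[simp] theorem qInner_eb_two (u : ℍ[ℝ]) : qInner u (eb 2) = u.imK := by
  simp [qInner]

theorem qInner_mul_mul_star (p v : ℍ[ℝ]) (i : Fin 3) :
    qInner v (p * eb i * star p) = qInner (starConj p v) (eb i) := by
  fin_cases i <;> simp [qInner, starConj_apply] <;> ring

@[simp] theorem qCross_re (u v : ℍ[ℝ]) : (qCross u v).re = 0 := rfl

@[simp] theorem qCross_imI (u v : ℍ[ℝ]) : (qCross u v).imI = u.imJ * v.imK - u.imK * v.imJ := rfl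

@[simp] theorem qCross_imJ (u v : ℍ[ℝ]) : (qCross u v).imJ = u.imK * v.imI - u.imI * v.imK := rfl

@[simp] theorem qCross_imK (u v : ℍ[ℝ]) : (qCross u v).imK = u.imI * v.imJ - u.imJ * v.imI := rfl

theorem qCross_eq {u v : ℍ[ℝ]} (hu : u.re = 0) (hv : v.re = 0) :
    qCross u v = (1 / 2 : ℝ) • (u * v - v * u) := by
  ext <;> simp [qCross, hu, hv] <;> ring

theorem starConj_qCross {p u v : ℍ[ℝ]} (hp : p * star p = 1) (hu : u.re = 0) (hv : v.re = 0) :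
    starConj p (qCross u v) = qCross (starConj p u) (starConj p v) := by
  rw [qCross_eq hu hv, qCross_eq (starConj_re hu) (starConj_re hv), map_smul, map_sub,
    starConj_mul hp, starConj_mul hp]

/-- The algebraic core of the dynamical system for `q`: a tangent vector `d` to the unit
quaternions at `p` is determined by the induced variations of the rotation columns. -/
theorem tangent_eq_of_rotation_variation {p d G F : ℍ[ℝ]} {Vs Va : Fin 3 → Fin 3 → ℍ[ℝ]}
    {R : Fin 3 → ℍ[ℝ]} {m : Fin 3}
    (hp : star p * p = 1) (hp' : p * star p = 1) (hd : star d * p + star p * d = 0)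
    (hG : G.re = 0) (hVs : ∀ i k, Vs i k = Vs k i)
    (hR : ∀ i, R i = p * eb i * star p)
    (hF : F = G + (2 / 3 : ℝ) • ∑ i, ∑ j, qInner (Vs i j) (R i) • R j)
    (h : ∀ i, d * eb i * star p + p * eb i * star d =
          (∑ k, qInner (eb m) (Va i k) • R k)
        - (∑ k, qInner (R k) (eb m) • Vs i k)
        + (∑ j, ∑ k, (qInner (Vs j k) (R i) * qInner (R k) (eb m)) • R j)
        + qInner F (R i) • eb m
        - qInner (R i) (eb m) • F) :
    d = (1 / 2 : ℝ) • (p * amQ p Vs Va m + qCross G (eb m) * p) := by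
  have hTR (i : Fin 3) : starConj p (R i) = eb i := by rw [hR, starConj_mul_mul_star hp]
  have hin (v : ℍ[ℝ]) (i : Fin 3) : qInner v (R i) = qInner (starConj p v) (eb i) := by
    rw [hR, qInner_mul_mul_star]
  have hin' (v : ℍ[ℝ]) (i : Fin 3) : qInner (R i) v = qInner (starConj p v) (eb i) := by
    rw [qInner_comm, hin]
  have hstar : star d * p = -(star p * d) := eq_neg_of_add_eq_zero_left hd
  have hre : (star p * d).re = 0 := by
    have := congrArg QuaternionAlgebra.re hd
    simp at this ⊢
    linarith
  have hL (i : Fin 3) : starConj p (d * eb i * star p + p * eb i * star d)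
      = star p * d * eb i - eb i * (star p * d) := by
    calc starConj p (d * eb i * star p + p * eb i * star d)
        = star p * d * eb i * (star p * p) + (star p * p) * eb i * (star d * p) := by
          rw [starConj_apply]; noncomm_ring
      _ = _ := by rw [hp, hstar]; noncomm_ring
  have hTF : starConj p F = starConj p G
      + (2 / 3 : ℝ) • ∑ i, ∑ j, qInner (starConj p (Vs i j)) (eb i) • eb j := by
    rw [hF]
    simp only [map_add, map_smul, map_sum, hTR, hin]
  have hS (i : Fin 3) := (hL i).symm.trans (congrArg (starConj p) (h i))
  simp only [map_add, map_sub, map_smul, map_sum, hTR, hin, hin', hTF] at hS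
  suffices hu : star p * d = (1 / 2 : ℝ) • (amQ p Vs Va m + starConj p (qCross G (eb m))) by
    calc d = p * (star p * d) := by rw [← mul_assoc, hp', one_mul]
      _ = _ := by rw [hu, mul_smul_comm, mul_add, mul_starConj hp']
  rw [starConj_qCross hp' hG (eb_re m)]
  simp only [amQ, ← starConj_apply]
  generalize star p * d = u at *
  generalize starConj p (eb m) = t at *
  generalize starConj p G = g at *
  have h01 := hVs 0 1
  have h02 := hVs 0 2
  have h12 := hVs 1 2
  have hI := congrArg QuaternionAlgebra.imK (hS 1)
  have hJ := congrArg QuaternionAlgebra.imI (hS 2)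
  have hK := congrArg QuaternionAlgebra.imJ (hS 0)
  clear hS hL h hTF hF hin hin' hTR
  simp [Fin.sum_univ_three, ← h01, ← h02, ← h12, hre] at hI hJ hK
  ext
  · simp [hre]
  · simp [Fin.sum_univ_three, ← h01, ← h02, ← h12]
    linarith
  · simp [Fin.sum_univ_three, ← h01, ← h02, ← h12]
    linarith
  · simp [Fin.sum_univ_three, ← h01, ← h02, ← h12]
    linarith

/-- if the rotation columns `R_i = q·e_i·q̄` of a unit-quaternion
field `q` satisfy the gradient equations of the `(σ, R)` system, with
`F = G + (2/3) Σ_{i,j} ⟨V_{ij}^s, R_i⟩ R_j`, then `q` satisfies the dynamical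
system `∂_m q = (1/2)(q·𝐚^m + 𝐛^m·q)` with `𝐛^m = G × e_m` and `𝐚^m` as in
`amQ`. -/
theorem stmt13
    (X : Set (EuclideanSpace ℝ (Fin 3))) (hX : IsOpen X)
    (V : Fin 3 → Fin 3 → EuclideanSpace ℝ (Fin 3) → ℍ[ℝ])
    (hVim : ∀ i k x, (V i k x).re = 0)
    (G : EuclideanSpace ℝ (Fin 3) → ℍ[ℝ]) (hGim : ∀ x, (G x).re = 0)
    (q : EuclideanSpace ℝ (Fin 3) → ℍ[ℝ])
    (hq : ∀ x ∈ X, DifferentiableAt ℝ q x)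
    (hunit : ∀ x ∈ X, ‖q x‖ = 1)
    (R : Fin 3 → EuclideanSpace ℝ (Fin 3) → ℍ[ℝ])
    (hR : ∀ i x, R i x = q x * eb i * star (q x))
    (Vs Va : Fin 3 → Fin 3 → EuclideanSpace ℝ (Fin 3) → ℍ[ℝ])
    (hVs : ∀ i k x, Vs i k x = (1 / 2 : ℝ) • (V i k x + V k i x))
    (hVa : ∀ i k x, Va i k x = (1 / 2 : ℝ) • (V i k x - V k i x))
    (F : EuclideanSpace ℝ (Fin 3) → ℍ[ℝ])
    (hF : ∀ x, F x = G x + (2 / 3 : ℝ) • ∑ i, ∑ j, qInner (Vs i j x) (R i x) • R j x)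
    (hdR : ∀ x ∈ X, ∀ m i : Fin 3,
      fderiv ℝ (R i) x (EuclideanSpace.single m 1) =
          (∑ k, qInner (eb m) (Va i k x) • R k x)
        - (∑ k, qInner (R k x) (eb m) • Vs i k x)
        + (∑ j, ∑ k, (qInner (Vs j k x) (R i x) * qInner (R k x) (eb m)) • R j x)
        + qInner (F x) (R i x) • eb m
        - qInner (R i x) (eb m) • F x) :
    ∀ x ∈ X, ∀ m : Fin 3,
      fderiv ℝ q x (EuclideanSpace.single m 1) =
        (1 / 2 : ℝ) • (q x * amQ (q x) (fun i k => Vs i k x) (fun i k => Va i k x) m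
          + qCross (G x) (eb m) * q x) := by
  intro x hx m
  have hp (y) (hy : y ∈ X) : star (q y) * q y = 1 := by
    rw [Quaternion.star_mul_self, Quaternion.normSq_eq_norm_mul_self, hunit y hy]
    simp
  have hp' : q x * star (q x) = 1 := by
    rw [Quaternion.self_mul_star, Quaternion.normSq_eq_norm_mul_self, hunit x hx]
    simp
  have : StarModule ℝ ℍ[ℝ] := ⟨fun r a => by rw [Quaternion.star_smul, star_trivial r]⟩
  have hqx := (hq x hx).hasFDerivAt
  have hconst : (fun y => star (q y) * q y) =ᶠ[nhds x] fun _ => 1 := by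
    filter_upwards [hX.mem_nhds hx] with y hy using hp y hy
  have hd := DFunLike.congr_fun ((hqx.star.mul' hqx).unique
    ((hasFDerivAt_const (1 : ℍ[ℝ]) x).congr_of_eventuallyEq hconst))
    (EuclideanSpace.single m 1)
  refine tangent_eq_of_rotation_variation (R := fun i => R i x) (F := F x) (hp x hx) hp' ?_
    (hGim x) (fun i k => ?_) (fun i => hR i x) (hF x) (fun i => ?_)
  · simpa [add_comm] using hd
  · simp only [hVs, add_comm]
  · have hRx : HasFDerivAt (R i) _ x :=
      ((hqx.mul_const' (eb i)).mul' hqx.star).congr_of_eventuallyEq (.of_eq (funext (hR i)))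
    rw [← hdR x hx m i, hRx.fderiv]
    simp [add_comm]
end

section
/- Let à ∈ M₃(ℝ) be symmetric and invertible, let S₁, S₂, S₃ ∈ ℝ³ and z₁, z₂, z₃ ∈ ℝ³ be vectors satisfying z₁ × (Ã⁻¹S₁) + z₂ × (Ã⁻¹S₂) + z₃ × (Ã⁻¹S₃) = 0, and set H_{ij} := ⟨S_i, S_j⟩ for 1 ≤ i,j ≤ 3. Then for every pair (p,q) with p,q ∈ {1,2,3}, Σ_{i=1}^3 ( H_{pi} ⟨z_i, ÃS_q⟩ − H_{qi} ⟨z_i, ÃS_p⟩ ) = 0. -/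
open Matrix

/-- For a symmetric invertible matrix `A`, the vectors `A⁻¹ x` and `A y` have the same inner
product as `y` and `x`. -/
theorem Matrix.IsSymm.inv_mulVec_dotProduct_mulVec {n R : Type*} [Fintype n] [DecidableEq n]
    [CommRing R] {A : Matrix n n R} (hsym : A.IsSymm) (hinv : IsUnit A.det) (x y : n → R) :
    A⁻¹ *ᵥ x ⬝ᵥ A *ᵥ y = y ⬝ᵥ x := by
  rw [dotProduct_mulVec, ← mulVec_transpose, hsym.eq, mulVec_mulVec, mul_nonsing_inv A hinv,
    one_mulVec, dotProduct_comm]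

/-- if `Ã` is symmetric invertible, `Σ_i z_i × (Ã⁻¹S_i) = 0` and
`H_{ij} = ⟨S_i, S_j⟩`, then for every pair `(p,q)`,
`Σ_i (H_{pi}⟨z_i, ÃS_q⟩ − H_{qi}⟨z_i, ÃS_p⟩) = 0`. -/
theorem stmt16
    (At : Matrix (Fin 3) (Fin 3) ℝ) (hsym : At.IsSymm) (hinv : IsUnit At.det)
    (S z : Fin 3 → Fin 3 → ℝ)
    (hcross : ∑ i, crossProduct (z i) (At⁻¹.mulVec (S i)) = 0)
    (H : Fin 3 → Fin 3 → ℝ) (hH : ∀ i j, H i j = S i ⬝ᵥ S j) :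
    ∀ p q : Fin 3,
      ∑ i, (H p i * (z i ⬝ᵥ At.mulVec (S q)) - H q i * (z i ⬝ᵥ At.mulVec (S p))) = 0 := by
  intro p q
  have term_eq (i : Fin 3) :
      H p i * (z i ⬝ᵥ At.mulVec (S q)) - H q i * (z i ⬝ᵥ At.mulVec (S p)) =
        crossProduct (z i) (At⁻¹.mulVec (S i)) ⬝ᵥ
          crossProduct (At.mulVec (S q)) (At.mulVec (S p)) := by
    rw [cross_dot_cross, hsym.inv_mulVec_dotProduct_mulVec hinv,
      hsym.inv_mulVec_dotProduct_mulVec hinv, hH, hH]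
    ring
  simp_rw [term_eq]
  rw [← sum_dotProduct, hcross, zero_dotProduct]
end
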